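/- Let (A,T̄_A,μ̄_A) be the induced system of the pin-sequence space on the set A={(x,z)∈P : z_0=1}, let q_{j,s}=μ̄_A(Q_{j,s}) be the measure of the set of points with first-return time j whose initial block of length j lies in the language of X_s (with the class s=0 collecting blocks belonging to some X_s with s≥⌊log₂ j⌋−2), and let h_s=h_top(X_s,T)=2^{-s}. Then for any T̄_A-invariant probability measure μ̄_A on A: h_{μ̄_A}(T̄_A) ≤ 2 + ∑_{j=1}^∞ ( q_{j,0}(8+3 log₂ j) + ∑_{s=1}^{⌊log₂ j⌋−3} q_{j,s}(j h_s + 3 log₂ j) ). -/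

import Mathlib

open MeasureTheory Real Filter Topology

noncomputable section

namespace PhaseTransitions

/-! ### Measure-theoretic entropy and topological pressure -/

/-- Base-2 entropy of the (finite, measurable) partition of `X` induced by an
observable `f : X → F` with finitely many values. -/
def entOfObs {X F : Type*} [MeasurableSpace X] [Fintype F]
    (μ : Measure X) (f : X → F) : ℝ :=
  ∑ a : F, -((μ (f ⁻¹' {a})).toReal * Real.logb 2 (μ (f ⁻¹' {a})).toReal)

/-- Entropy of the transformation `T` with respect to the partition induced by
the observable `f` : the limit (= infimum) of `(1/n) H(⋁_{i<n} T⁻ⁱ f)`. -/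
def entObsT {X F : Type*} [MeasurableSpace X] [Fintype F]
    (T : X → X) (μ : Measure X) (f : X → F) : ℝ :=
  ⨅ n : ℕ, entOfObs μ (fun x => fun i : Fin (n + 1) => f (T^[(i : ℕ)] x)) / (n + 1)

/-- Kolmogorov–Sinai (measure-theoretic) entropy, base 2: supremum over all
finite measurable partitions (encoded by observables with values in `Fin k`). -/
def kolSinai {X : Type*} [MeasurableSpace X] (T : X → X) (μ : Measure X) : ℝ :=
  ⨆ k : ℕ, ⨆ f : {f : X → Fin k // Measurable f}, entObsT T μ f.1

/-- `μ` is a `T`-invariant Borel probability measure. -/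
def InvProb {X : Type*} [MeasurableSpace X] (T : X → X) (μ : Measure X) : Prop :=
  IsProbabilityMeasure μ ∧ MeasurePreserving T μ μ

/-- Topological pressure, via the variational principle. -/
def pressure {X : Type*} [MeasurableSpace X] (T : X → X) (φ : X → ℝ) : ℝ :=
  ⨆ μ : {μ : Measure X // InvProb T μ}, (kolSinai T μ.1 + ∫ x, φ x ∂μ.1)

/-- An equilibrium state of the potential `φ`: an invariant probability measure
attaining the supremum in the variational principle. -/
def IsEquilibrium {X : Type*} [MeasurableSpace X] (T : X → X) (φ : X → ℝ)
    (μ : Measure X) : Prop :=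
  InvProb T μ ∧ kolSinai T μ + ∫ x, φ x ∂μ = pressure T φ

/-! ### The two-sided full shift on two symbols -/

/-- The two-sided full shift space `{0,1}^ℤ`. -/
abbrev Bin : Type := ℤ → Bool

/-- The (left) shift map. -/
def shift (x : Bin) : Bin := fun n => x (n + 1)

/-- `x` is a bi-infinite free concatenation of words from `W`: there is a
bi-infinite increasing sequence of cut points, cofinal in both directions, such
that consecutive cut points delimit words of `W`. -/
def IsFreeConcat (W : Set (List Bool)) (x : Bin) : Prop :=
  ∃ t : ℤ → ℤ, StrictMono t ∧ (∀ N : ℤ, ∃ k, N < t k) ∧ (∀ N : ℤ, ∃ k, t k < N) ∧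
    ∀ k : ℤ, ∃ w ∈ W, t (k + 1) = t k + w.length ∧
      ∀ (i : ℕ) (h : i < w.length), x (t k + (i : ℤ)) = w.get ⟨i, h⟩

/-- The coded system generated by the word set `W`: the closure of the set of
free concatenations of words from `W`. -/
def codedSystem (W : Set (List Bool)) : Set Bin :=
  closure {x | IsFreeConcat W x}

/-- The generating set `W_n = {0^{2^n-1}1, 1^{2^n-1}0}`. -/
def genWords (n : ℕ) : Set (List Bool) :=
  {List.replicate (2 ^ n - 1) false ++ [true], List.replicate (2 ^ n - 1) true ++ [false]}

/-- The subshift `X_n`, the coded system generated by `W_n`. -/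
def Xsub (n : ℕ) : Set Bin := codedSystem (genWords n)

/-- The set of words of length `j` in the language of `Y ⊆ {0,1}^ℤ`. -/
def langWord (Y : Set Bin) (j : ℕ) : Set (Fin j → Bool) :=
  {w | ∃ x ∈ Y, ∀ i : Fin j, x ((i : ℕ) : ℤ) = w i}

/-! ### The metric and the potential -/

open Classical in
/-- The metric `d(x,y) = 2^{-inf{|n| : x_n ≠ y_n}}` on the shift space. -/
def binDist (x y : Bin) : ℝ :=
  if x = y then 0
  else (1 / 2 : ℝ) ^ sInf {m : ℕ | ∃ i : ℤ, i.natAbs = m ∧ x i ≠ y i}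

/-- Distance from a point to a set. -/
def distToSet (x : Bin) (S : Set Bin) : ℝ :=
  sInf ((fun y => binDist x y) '' S)

/-- `δ_j = (10 + 3 log₂ j)/(α j)`. -/
def deltaSeq (α : ℝ) (j : ℕ) : ℝ := (10 + 3 * Real.logb 2 j) / (α * j)

/-- The drop `δ` as a function of the distance `r`: if `r = 2^{-j}` this equals
`δ_j = (10 + 3 log₂ j)/(α j)`, and `δ = 0` when `r = 0` (i.e. `δ_∞ = 0`). -/
def deltaOf (α : ℝ) (r : ℝ) : ℝ :=
  if r = 0 then 0
  else (10 + 3 * Real.logb 2 (-Real.logb 2 r)) / (α * (-Real.logb 2 r))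

/-- `c_n = -∑_{j=n}^∞ 1/(2^{j+1} β_j)`. -/
def cseq (β : ℕ → ℝ) (n : ℕ) : ℝ :=
  -∑' k : ℕ, 1 / (2 ^ (n + k + 1) * β (n + k))

/-- `φ_n(x) = c_n − δ_j` when `dist(x, X_n) = 2^{-j}` (and `φ_n = c_n` on `X_n`). -/
def phiN (α : ℝ) (c : ℕ → ℝ) (n : ℕ) (x : Bin) : ℝ :=
  c n - deltaOf α (distToSet x (Xsub n))

/-- The potential `φ = sup_{n ≥ 1} φ_n`. -/
def phi (α : ℝ) (c : ℕ → ℝ) (x : Bin) : ℝ :=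
  ⨆ n : ℕ, phiN α c (n + 1) x

/-- The constants of the finite (truncated) construction:
`c_{n} = c_1 + ∑_{j=1}^{n-1} 1/(2^{j+1} β_j)`. -/
def cseqFin (c1 : ℝ) (β : ℕ → ℝ) (n : ℕ) : ℝ :=
  c1 + ∑ j ∈ Finset.Ico 1 n, 1 / (2 ^ (j + 1) * β j)

/-- The truncated potential `φ = max{φ_n : 1 ≤ n ≤ N+1}`. -/
def phiFin (α : ℝ) (c : ℕ → ℝ) (N : ℕ) (x : Bin) : ℝ :=
  ⨆ n : Fin (N + 1), phiN α c ((n : ℕ) + 1) x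

/-! ### Measures of maximal entropy and relative pressure -/

/-- `μ` is a measure of maximal entropy for the subsystem `Y` (a `T`-invariant
probability measure giving full mass to `Y` and maximizing entropy among such). -/
def IsMaxEntropyOn (Y : Set Bin) (μ : Measure Bin) : Prop :=
  InvProb shift μ ∧ μ Y = 1 ∧
    ∀ ν : Measure Bin, InvProb shift ν → ν Y = 1 → kolSinai shift ν ≤ kolSinai shift μ

/-- The topological pressure of the subsystem `Y` (computed via the variational
principle over invariant measures giving full mass to `Y`). -/
def pressureOn (Y : Set Bin) (φ : Bin → ℝ) : ℝ :=
  ⨆ μ : {μ : Measure Bin // InvProb shift μ ∧ μ Y = 1},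
    (kolSinai shift μ.1 + ∫ x, φ x ∂μ.1)

/-! ### The pin-sequence space -/

/-- `Y`, the closure of the union of the `X_n`, `n ≥ 1`. -/
def Yset : Set Bin := closure (⋃ n : ℕ, Xsub (n + 1))

/-- The word `x_i ⋯ x_j` belongs to the language of `Y`. -/
def SegIn (x : Bin) (i j : ℤ) (Y : Set Bin) : Prop :=
  ∃ y ∈ Y, ∀ m : ℤ, i ≤ m → m ≤ j → y (m - i) = x m

/-- The word `x_0 ⋯ x_{j-1}` belongs to the language of `Y`. -/
def WordIn (x : Bin) (j : ℕ) (Y : Set Bin) : Prop :=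
  ∃ y ∈ Y, ∀ m : ℕ, m < j → y (m : ℤ) = x (m : ℤ)

/-- The pin-sequence space `P ⊆ X × {0,1}^ℤ`: pinless stretches of `x` lie in the
language of `Y`, and stretches between two pins do not. -/
def PinSpace : Set (Bin × Bin) :=
  {p | (∀ i j : ℤ, i < j → (∀ k : ℤ, i < k → k ≤ j → p.2 k = false) → SegIn p.1 i j Yset) ∧
       (∀ i j : ℤ, i < j → p.2 i = true → p.2 j = true → ¬ SegIn p.1 i j Yset)}

/-- The product shift `T̄(x,z) = (Tx, Tz)`. -/
def shift2 (p : Bin × Bin) : Bin × Bin := (shift p.1, shift p.2)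

/-- The set `A = {(x,z) ∈ P : z_0 = 1}`. -/
def Aset : Set (Bin × Bin) := {p | p ∈ PinSpace ∧ p.2 0 = true}

/-- The first return time to `A`. -/
def retTime (p : Bin × Bin) : ℕ :=
  sInf {k : ℕ | 1 ≤ k ∧ shift2^[k] p ∈ Aset}

/-- The induced (first-return) map `T̄_A`. -/
def inducedMap (p : Bin × Bin) : Bin × Bin := shift2^[retTime p] p

/-- `Q_j`, the set of points of `A` with first return time `j`. -/
def Qset (j : ℕ) : Set (Bin × Bin) := {p | p ∈ Aset ∧ retTime p = j}

/-- `Q_{j,s}` for `1 ≤ s ≤ ⌊log₂ j⌋ - 3`: points of `Q_j` whose initial block of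
length `j` lies in the language of `X_s`; the class `s = 0` collects the blocks
belonging to some `X_{s'}` with `s' ≥ ⌊log₂ j⌋ - 2`. -/
def Qjs (j s : ℕ) : Set (Bin × Bin) :=
  if s = 0 then
    {p | p ∈ Qset j ∧ ∃ s' : ℕ, 1 ≤ s' ∧ Nat.log 2 j - 2 ≤ s' ∧ WordIn p.1 j (Xsub s')}
  else {p | p ∈ Qset j ∧ WordIn p.1 j (Xsub s)}

/-! ### Entropy bounds from weighted codes -/

/-- The total mass of a product weight on tuples is a power of the total mass of the weight. -/
theorem tsum_pi_prod {α : Type*} (w : α → ENNReal) (n : ℕ) :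
    ∑' c : Fin n → α, ∏ i, w (c i) = (∑' a, w a) ^ n := by
  induction n with
  | zero => simp
  | succ n ih =>
    rw [← (Fin.consEquiv fun _ : Fin (n + 1) => α).tsum_eq, ENNReal.tsum_prod']
    simp only [Fin.consEquiv, Equiv.coe_fn_mk, Fin.prod_univ_succ, Fin.cons_zero, Fin.cons_succ]
    simp_rw [ENNReal.tsum_mul_left, ih, ENNReal.tsum_mul_right]
    rw [pow_succ']

/-- The termwise form of Gibbs' inequality. -/
theorem neg_mul_logb_le {q r : ℝ} (hq : 0 ≤ q) (hr : 0 ≤ r) (h : q ≠ 0 → 0 < r) :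
    -(q * Real.logb 2 q) ≤ q * -Real.logb 2 r + (r - q) / Real.log 2 := by
  have h2 : 0 < Real.log 2 := Real.log_pos (by norm_num)
  rcases hq.eq_or_lt with rfl | hq
  · simpa using div_nonneg hr h2.le
  have hr' := h hq.ne'
  have key := Real.log_le_sub_one_of_pos (div_pos hr' hq)
  rw [Real.log_div hr'.ne' hq.ne'] at key
  have : q * (Real.log r - Real.log q) ≤ r - q := by
    calc q * (Real.log r - Real.log q) ≤ q * (r / q - 1) := by gcongr
      _ = r - q := by field_simp
  have h3 := div_le_div_of_nonneg_right this h2.le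
  simp only [Real.logb]
  have e : q * (Real.log r - Real.log q) / Real.log 2 =
    q * (Real.log r / Real.log 2) - q * (Real.log q / Real.log 2) := by ring
  linarith

/-- If a code `C` with subprobability weight `w` determines the observable `F` on a set of full
measure, then the entropy of `F` is at most the expected code length `-log₂ w`. -/
theorem entOfObs_le_lintegral_of_code {X F 𝒞 : Type*} [MeasurableSpace X] [Fintype F]
    (ν : Measure X) [IsProbabilityMeasure ν] (f : X → F)
    (hf : ∀ a, MeasurableSet (f ⁻¹' {a})) (G : Set X) (hG : ∀ᵐ p ∂ν, p ∈ G)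
    (C : X → 𝒞) (w : 𝒞 → ℝ) (hw : ∑' c, ENNReal.ofReal (w c) ≤ 1)
    (hdet : ∀ p ∈ G, ∀ p' ∈ G, C p = C p' → f p = f p')
    (hpos : ∀ p ∈ G, 0 < w (C p)) (cost : X → ENNReal)
    (hcost : ∀ p ∈ G, ENNReal.ofReal (-Real.logb 2 (w (C p))) ≤ cost p) :
    ENNReal.ofReal (entOfObs ν f) ≤ ∫⁻ p, cost p ∂ν := by
  classical
  set P : F → ENNReal := fun a =>
    ∑' c, if ∃ p ∈ G, C p = c ∧ f p = a then ENNReal.ofReal (w c) else 0 with hP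
  have hPsum : ∑ a, P a ≤ 1 := by
    refine le_trans ?_ hw
    rw [← tsum_fintype (L := SummationFilter.unconditional F), ENNReal.tsum_comm]
    refine ENNReal.tsum_le_tsum fun c => ?_
    rw [tsum_fintype]
    by_cases h : ∃ p ∈ G, C p = c
    · obtain ⟨p, hp, rfl⟩ := h
      rw [Finset.sum_eq_single (f p)]
      · split_ifs <;> simp
      · intro a _ ha
        rw [if_neg]
        rintro ⟨p', hp', h1, h2⟩
        exact ha (h2 ▸ hdet p' hp' p hp h1)
      · simp
    · refine (Finset.sum_eq_zero fun a _ => if_neg ?_).trans_le zero_le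
      rintro ⟨p, hp, h1, -⟩
      exact h ⟨p, hp, h1⟩
  have hP1 : ∀ a, P a ≤ 1 := fun a =>
    (Finset.single_le_sum (f := P) (fun _ _ => zero_le) (Finset.mem_univ a)).trans hPsum
  have hPtop : ∀ a, P a ≠ ⊤ := fun a => ((hP1 a).trans_lt ENNReal.one_lt_top).ne
  have hPw : ∀ p ∈ G, w (C p) ≤ (P (f p)).toReal := by
    intro p hp
    rw [← ENNReal.ofReal_le_iff_le_toReal (hPtop _)]
    refine le_trans ?_ (ENNReal.le_tsum (C p))
    rw [if_pos ⟨p, hp, rfl, rfl⟩]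
  set q : F → ℝ := fun a => (ν (f ⁻¹' {a})).toReal with hq
  have hex : ∀ a, q a ≠ 0 → ∃ p ∈ G, f p = a := by
    intro a ha
    by_contra! hcon
    refine ha ?_
    have : ν (f ⁻¹' {a}) = 0 := by
      refine measure_mono_null ?_ (ae_iff.1 hG)
      intro p hp hpG
      exact hcon p hpG hp
    simp [hq, this]
  have hqsum : ∑ a, q a = 1 := by
    have h1 : ∑ a, ν (f ⁻¹' {a}) = 1 := by
      rw [sum_measure_preimage_singleton _ fun a _ => hf a]
      simp
    simp only [hq]
    rw [← ENNReal.toReal_sum fun a _ => measure_ne_top _ _, h1, ENNReal.toReal_one]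
  have hPr : ∑ a, (P a).toReal ≤ 1 := by
    rw [← ENNReal.toReal_sum fun a _ => hPtop a]
    exact ENNReal.toReal_le_of_le_ofReal zero_le_one (by simpa using hPsum)
  have h2 : 0 < Real.log 2 := Real.log_pos (by norm_num)
  have hent : entOfObs ν f ≤ ∑ a, q a * -Real.logb 2 (P a).toReal := by
    have : entOfObs ν f ≤
        ∑ a, (q a * -Real.logb 2 (P a).toReal + ((P a).toReal - q a) / Real.log 2) := by
      refine Finset.sum_le_sum fun a _ => neg_mul_logb_le ENNReal.toReal_nonneg
        ENNReal.toReal_nonneg fun ha => ?_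
      obtain ⟨p, hp, rfl⟩ := hex a ha
      exact (hpos p hp).trans_le (hPw p hp)
    rw [Finset.sum_add_distrib, ← Finset.sum_div, Finset.sum_sub_distrib, hqsum] at this
    have h3 : (∑ a, (P a).toReal - 1) / Real.log 2 ≤ 0 :=
      div_nonpos_of_nonpos_of_nonneg (by linarith) h2.le
    linarith
  calc ENNReal.ofReal (entOfObs ν f)
      ≤ ENNReal.ofReal (∑ a, q a * -Real.logb 2 (P a).toReal) := ENNReal.ofReal_le_ofReal hent
    _ ≤ ∑ a, ENNReal.ofReal (-Real.logb 2 (P a).toReal) * ν (f ⁻¹' {a}) := by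
        rw [ENNReal.ofReal_sum_of_nonneg]
        · refine Finset.sum_le_sum fun a _ => ?_
          rw [ENNReal.ofReal_mul ENNReal.toReal_nonneg, mul_comm,
            ENNReal.ofReal_toReal (measure_ne_top _ _)]
        · intro a _
          refine mul_nonneg ENNReal.toReal_nonneg (neg_nonneg.2 ?_)
          refine Real.logb_nonpos (by norm_num) ENNReal.toReal_nonneg ?_
          exact ENNReal.toReal_le_of_le_ofReal zero_le_one (by simpa using hP1 a)
    _ = ∫⁻ p, ∑ a, (f ⁻¹' {a}).indicator
          (fun _ => ENNReal.ofReal (-Real.logb 2 (P a).toReal)) p ∂ν := by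
        rw [lintegral_finsetSum _ fun a _ => measurable_const.indicator (hf a)]
        simp only [lintegral_indicator_const (hf _)]
    _ ≤ ∫⁻ p, cost p ∂ν := by
        refine lintegral_mono_ae ?_
        filter_upwards [hG] with p hp
        rw [Finset.sum_eq_single (f p)]
        · rw [Set.indicator_of_mem (by simp)]
          refine le_trans (ENNReal.ofReal_le_ofReal ?_) (hcost p hp)
          exact neg_le_neg (Real.logb_le_logb_of_le (by norm_num) (hpos p hp) (hPw p hp))
        · intro a _ ha
          exact Set.indicator_of_notMem (fun h => ha (by simpa using h.symm)) _
        · simp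

/-- Entropy of an observable is unchanged under composition with a measure-preserving map. -/
theorem entOfObs_comp {X F : Type*} [MeasurableSpace X] [Fintype F]
    {ν : Measure X} {S : X → X} (hS : MeasurePreserving S ν ν) (f : X → F)
    (hf : ∀ a, MeasurableSet (f ⁻¹' {a})) : entOfObs ν (fun x => f (S x)) = entOfObs ν f := by
  refine Finset.sum_congr rfl fun a _ => ?_
  have : (fun x => f (S x)) ⁻¹' {a} = S ⁻¹' (f ⁻¹' {a}) := rfl
  rw [this, hS.measure_preimage (hf a).nullMeasurableSet]

/-! ### Words of the coded subshifts -/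

/-- The letter at position `m` in the concatenation of the blocks `b^(N-1) (!b)`. -/
def blockLetter (N : ℕ) (b : ℕ → Bool) (m : ℕ) : Bool :=
  if m % N = N - 1 then !(b (m / N)) else b (m / N)

theorem IsFreeConcat.exists_blockLetter {s : ℕ} {y : Bin} (hy : IsFreeConcat (genWords s) y) :
    ∃ a < 2 ^ s, ∃ b : ℕ → Bool, ∀ m : ℕ, y m = blockLetter (2 ^ s) b (a + m) := by
  obtain ⟨t, -, -, -, ht⟩ := hy
  have hN : 0 < 2 ^ s := by positivity
  set N : ℕ := 2 ^ s with hNdef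
  have hblock : ∀ k, t (k + 1) = t k + N ∧ ∃ c : Bool, ∀ i < N,
      y (t k + (i : ℤ)) = if i = N - 1 then !c else c := by
    intro k
    obtain ⟨w, hw, h1, h2⟩ := ht k
    have hw' : ∃ c : Bool, w = List.replicate (N - 1) c ++ [!c] := by
      rcases hw with hw | hw
      · exact ⟨false, hw⟩
      · exact ⟨true, hw⟩
    obtain ⟨c, rfl⟩ := hw'
    have hlen : (List.replicate (N - 1) c ++ [!c]).length = N := by simp; omega
    rw [hlen] at h1
    refine ⟨h1, c, fun i hi => ?_⟩
    rw [h2 i (by rw [hlen]; exact hi)]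
    simp only [List.get_eq_getElem, List.getElem_append, List.length_replicate]
    split_ifs with h3 h4 h4
    · omega
    · simp
    · simp
    · omega
  have hstep : ∀ k : ℤ, t k = t 0 + k * N := by
    intro k
    induction k using Int.induction_on with
    | zero => simp
    | succ i ih => rw [(hblock _).1, ih]; ring
    | pred i ih =>
      have := (hblock (-(i : ℤ) - 1)).1
      rw [sub_add_cancel, ih] at this
      linarith
  choose _ c hc using hblock
  set k : ℤ := (-t 0) / N with hk
  have hN' : (0 : ℤ) < N := by exact_mod_cast hN
  have ha0 := Int.emod_nonneg (-t 0) hN'.ne'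
  have ha1 := Int.emod_lt_of_pos (-t 0) hN'
  have hdiv := Int.mul_ediv_add_emod (-t 0) N
  refine ⟨((-t 0) % N).toNat, by omega, fun q => c (k + q), fun m => ?_⟩
  set a := ((-t 0) % N).toNat with ha
  have haZ : (a : ℤ) = (-t 0) % N := by omega
  have h1 := hc (k + ((a + m) / N : ℕ)) ((a + m) % N) (Nat.mod_lt _ hN)
  have h2 : ((N * ((a + m) / N) + (a + m) % N : ℕ) : ℤ) = (a + m : ℕ) := by
    rw [Nat.div_add_mod]
  have h3 : t (k + ((a + m) / N : ℕ)) + (((a + m) % N : ℕ) : ℤ) = m := by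
    rw [hstep]
    push_cast at h2 ⊢
    rw [← hk, ← haZ] at hdiv
    linarith
  rw [h3] at h1
  exact h1

/-- Words seen in a closure are already seen in the set itself. -/
theorem exists_agree_of_mem_closure {S : Set Bin} {x : Bin} (hx : x ∈ closure S) (J : ℕ) :
    ∃ y ∈ S, ∀ m : ℕ, m < J → y m = x m := by
  have hU : IsOpen {y : Bin | ∀ i : Fin J, y ((i : ℕ) : ℤ) = x ((i : ℕ) : ℤ)} := by
    have h : {y : Bin | ∀ i : Fin J, y ((i : ℕ) : ℤ) = x ((i : ℕ) : ℤ)} =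
        ⋂ i : Fin J, (fun y : Bin => y ((i : ℕ) : ℤ)) ⁻¹' {x ((i : ℕ) : ℤ)} := by
      ext y
      simp
    rw [h]
    exact isOpen_iInter_of_finite fun i =>
      (isOpen_discrete {x ((i : ℕ) : ℤ)}).preimage (continuous_apply ((i : ℕ) : ℤ))
  obtain ⟨y, hy, hyS⟩ := mem_closure_iff.1 hx _ hU fun _ => rfl
  exact ⟨y, hyS, fun m hm => hy ⟨m, hm⟩⟩

theorem exists_blockLetter_of_mem_langWord {s J : ℕ} {w : Fin J → Bool}
    (hw : w ∈ langWord (Xsub s) J) :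
    ∃ a < 2 ^ s, ∃ b : ℕ → Bool, ∀ i : Fin J, w i = blockLetter (2 ^ s) b (a + i) := by
  obtain ⟨x, hx, hxw⟩ := hw
  obtain ⟨y, hy, hyx⟩ := exists_agree_of_mem_closure hx J
  obtain ⟨a, ha, b, hb⟩ := IsFreeConcat.exists_blockLetter hy
  refine ⟨a, ha, b, fun i => ?_⟩
  rw [← hxw, ← hyx i i.2, hb]

theorem ncard_le_card_of_subset_range {α β : Type*} [Fintype α] {S : Set β} (f : α → β)
    (h : S ⊆ Set.range f) : S.ncard ≤ Fintype.card α := by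
  calc S.ncard ≤ (Set.range f).ncard := Set.ncard_le_ncard h (Set.finite_range f)
    _ = (f '' Set.univ).ncard := by rw [Set.image_univ]
    _ ≤ (Set.univ : Set α).ncard := Set.ncard_image_le
    _ = Fintype.card α := by rw [Set.ncard_univ, Nat.card_eq_fintype_card]

theorem ncard_langWord_Xsub_le (s J : ℕ) :
    (langWord (Xsub s) J).ncard ≤ 2 ^ s * 2 ^ (J / 2 ^ s + 2) := by
  have hN : 0 < 2 ^ s := by positivity
  let f : Fin (2 ^ s) × (Fin (J / 2 ^ s + 2) → Bool) → (Fin J → Bool) := fun p i =>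
    blockLetter (2 ^ s) (fun q => if h : q < J / 2 ^ s + 2 then p.2 ⟨q, h⟩ else false) (p.1 + i)
  have := ncard_le_card_of_subset_range (S := langWord (Xsub s) J) f ?_
  · simpa using this
  · intro w hw
    obtain ⟨a, ha, b, hb⟩ := exists_blockLetter_of_mem_langWord hw
    refine ⟨(⟨a, ha⟩, fun q => b q), funext fun i => ?_⟩
    have hq : (a + i) / 2 ^ s < J / 2 ^ s + 2 := by
      have h1 : a + i ≤ J + 2 ^ s := by omega
      have h2 := Nat.div_le_div_right (c := 2 ^ s) h1
      rw [Nat.add_div_right _ hN] at h2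
      omega
    rw [hb]
    simp only [f, blockLetter, hq, dite_true]

/-- There are at most `4 J` words of length `J` in the languages of the `X_s` with `J < 2^s`. -/
theorem ncard_iUnion_langWord_le {J : ℕ} (hJ : 0 < J) :
    {w : Fin J → Bool | ∃ s, J < 2 ^ s ∧ w ∈ langWord (Xsub s) J}.ncard ≤ 4 * J := by
  let f : Fin J × (Bool × Bool) → (Fin J → Bool) := fun p i =>
    if i < p.1 then p.2.1 else if i = p.1 then !p.2.1 else p.2.2
  have := ncard_le_card_of_subset_range
    (S := {w : Fin J → Bool | ∃ s, J < 2 ^ s ∧ w ∈ langWord (Xsub s) J}) f ?_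
  · simpa [mul_comm] using this
  · rintro w ⟨s, hs, hw⟩
    obtain ⟨a, ha, b, hb⟩ := exists_blockLetter_of_mem_langWord hw
    set N := 2 ^ s
    have hlow : ∀ m, m < N → blockLetter N b m = if m = N - 1 then !(b 0) else b 0 := by
      intro m hm
      rw [blockLetter, Nat.mod_eq_of_lt hm, Nat.div_eq_of_lt hm]
    have hhigh : ∀ m, N ≤ m → m < 2 * N - 1 → blockLetter N b m = b 1 := by
      intro m hm hm'
      have h1 : m = (m - N) + N := by omega
      rw [blockLetter, h1, Nat.add_mod_right, Nat.add_div_right _ (by omega),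
        Nat.mod_eq_of_lt (by omega), Nat.div_eq_of_lt (by omega), if_neg (by omega)]
    by_cases hc : N - 1 - a < J
    · refine ⟨(⟨N - 1 - a, hc⟩, (b 0, b 1)), funext fun i => ?_⟩
      rw [hb]
      simp only [f, Fin.lt_def, Fin.ext_iff]
      have hi := i.2
      split_ifs with h1 h2
      · rw [hlow _ (by omega), if_neg (by omega)]
      · rw [hlow _ (by omega), if_pos (by omega)]
      · rw [hhigh _ (by omega) (by omega)]
    · refine ⟨(⟨0, hJ⟩, (!(b 0), b 0)), funext fun i => ?_⟩
      rw [hb, hlow _ (by omega), if_neg (by omega)]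
      simp only [f, Fin.lt_def, Fin.ext_iff]
      simp

/-- The words of length `J` in the class `s`: for `s ≥ 1` those in the language of `X_s`, for
`s = 0` those in the language of some `X_{s'}` with `s' ≥ ⌊log₂ J⌋ - 2`. -/
def classWords (J s : ℕ) : Set (Fin J → Bool) :=
  if s = 0 then {w | ∃ s' : ℕ, 1 ≤ s' ∧ Nat.log 2 J - 2 ≤ s' ∧ w ∈ langWord (Xsub s') J}
  else langWord (Xsub s) J

theorem ncard_classWords_zero_le {J : ℕ} (hJ : 0 < J) : (classWords J 0).ncard ≤ 256 * J := by
  set L := Nat.log 2 J with hL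
  have hLJ : 2 ^ L ≤ J := Nat.pow_log_le_self 2 hJ.ne'
  have hJL : J < 2 ^ (L + 1) := Nat.lt_pow_succ_log_self (by norm_num) J
  set V := {w : Fin J → Bool | ∃ s, J < 2 ^ s ∧ w ∈ langWord (Xsub s) J} with hV
  have hsub : classWords J 0 ⊆ V ∪ ⋃ s ∈ Finset.Icc (L - 2) L, langWord (Xsub s) J := by
    rintro w hw
    simp only [classWords, if_true] at hw
    obtain ⟨s, -, hs, hw⟩ := hw
    by_cases h : s ≤ L
    · refine Or.inr ?_
      simp only [Set.mem_iUnion]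
      exact ⟨s, Finset.mem_Icc.2 ⟨hs, h⟩, hw⟩
    · exact Or.inl ⟨s, hJL.trans_le (Nat.pow_le_pow_right (by norm_num) (by omega)), hw⟩
  have h1 : (classWords J 0).ncard ≤ 4 * J +
      ∑ s ∈ Finset.Icc (L - 2) L, 2 ^ s * 2 ^ (J / 2 ^ s + 2) := by
    refine (Set.ncard_le_ncard hsub (Set.toFinite _)).trans ((Set.ncard_union_le _ _).trans ?_)
    refine add_le_add (ncard_iUnion_langWord_le hJ) ?_
    refine (Finset.set_ncard_biUnion_le _ _).trans ?_
    exact Finset.sum_le_sum fun s _ => ncard_langWord_Xsub_le s J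
  have hterm : ∀ s d, L = s + d → 2 ^ s * 2 ^ (J / 2 ^ s + 2) ≤ 2 ^ s * 2 ^ (2 ^ (d + 1) + 1) := by
    intro s d hsd
    have h : J / 2 ^ s < 2 ^ (d + 1) := by
      rw [Nat.div_lt_iff_lt_mul (by positivity), ← pow_add]
      convert hJL using 2
      omega
    exact Nat.mul_le_mul_left _ (Nat.pow_le_pow_right (by norm_num) (by omega))
  have h2 : ∑ s ∈ Finset.Icc (L - 2) L, 2 ^ s * 2 ^ (J / 2 ^ s + 2) ≤ 152 * 2 ^ L := by
    rcases Nat.lt_or_ge L 2 with h | h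
    · interval_cases hL' : L
      · have := hterm 0 0 rfl
        norm_num at this ⊢
        omega
      · have a1 := hterm 0 1 rfl
        have a2 := hterm 1 0 rfl
        norm_num [Finset.sum_Icc_succ_top] at a1 a2 ⊢
        omega
    · obtain ⟨r, hr⟩ := Nat.exists_eq_add_of_le' h
      have a0 := hterm r 2 hr
      have a1 := hterm (r + 1) 1 hr
      have a2 := hterm (r + 2) 0 hr
      rw [hr, Nat.add_sub_cancel, Finset.sum_Icc_succ_top (by omega),
        Finset.sum_Icc_succ_top (by omega), Finset.Icc_self, Finset.sum_singleton]
      refine (add_le_add (add_le_add a0 a1) a2).trans ?_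
      norm_num [pow_succ]
      omega
  omega

/-- The excess code length, beyond `2`, of the words of length `J` in the class `s`. -/
def classCost (J s : ℕ) : ℝ :=
  if s = 0 then 8 + 3 * Real.logb 2 J else J * (1 / 2 : ℝ) ^ s + 3 * Real.logb 2 J

theorem classCost_nonneg {J : ℕ} (hJ : 0 < J) (s : ℕ) : 0 ≤ classCost J s := by
  have : 0 ≤ Real.logb 2 J := Real.logb_nonneg (by norm_num) (by exact_mod_cast hJ)
  unfold classCost
  split_ifs <;> positivity

/-- The classes into which the words of length `J` are sorted. -/
def classes (J : ℕ) : Finset ℕ := insert 0 (Finset.Icc 1 (Nat.log 2 J - 3))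

theorem rpow_neg_three_mul_logb {J : ℕ} (hJ : 0 < J) :
    (2 : ℝ) ^ (-(3 * Real.logb 2 J)) = ((J : ℝ) ^ 3)⁻¹ := by
  have hJ' : (0 : ℝ) < J := by exact_mod_cast hJ
  rw [Real.rpow_neg (by norm_num), mul_comm, Real.rpow_mul (by norm_num),
    Real.rpow_logb (by norm_num) (by norm_num) hJ']
  norm_cast

theorem ncard_classWords_mul_le {J s : ℕ} (hs : s ≠ 0) :
    ((classWords J s).ncard : ℝ) * (2 : ℝ) ^ (-(J * (1 / 2 : ℝ) ^ s)) ≤ 4 * 2 ^ s := by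
  have h1 : ((classWords J s).ncard : ℝ) ≤ 2 ^ s * (2 ^ (J / 2 ^ s) * 4) := by
    have := ncard_langWord_Xsub_le s J
    rw [pow_add] at this
    simp only [classWords, hs, if_false]
    exact_mod_cast this
  have h2 : (2 : ℝ) ^ (J / 2 ^ s) ≤ (2 : ℝ) ^ ((J : ℝ) * (1 / 2 : ℝ) ^ s) := by
    rw [← Real.rpow_natCast]
    refine Real.rpow_le_rpow_of_exponent_le (by norm_num) ?_
    refine Nat.cast_div_le.trans_eq ?_
    push_cast
    rw [one_div, inv_pow, div_eq_mul_inv]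
  rw [Real.rpow_neg (by norm_num), ← div_eq_mul_inv, div_le_iff₀ (by positivity)]
  refine h1.trans ?_
  nlinarith [pow_pos (two_pos : (0 : ℝ) < 2) s]

/-- The weights `2^(-2 - cost)` of the words of length `J` add up to at most `1 / (2 J²)`. -/
theorem sum_classes_ncard_mul_le {J : ℕ} (hJ : 0 < J) :
    ∑ s ∈ classes J, ((classWords J s).ncard : ℝ) * (2 : ℝ) ^ (-(2 + classCost J s)) ≤
      1 / (2 * (J : ℝ) ^ 2) := by
  have hJ' : (0 : ℝ) < J := by exact_mod_cast hJ
  set L := Nat.log 2 J with hL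
  have hLJ : (2 : ℝ) ^ L ≤ J := by exact_mod_cast Nat.pow_log_le_self 2 hJ.ne'
  have e0 : ((classWords J 0).ncard : ℝ) * (2 : ℝ) ^ (-(2 + classCost J 0)) ≤
      J * (((J : ℝ) ^ 3)⁻¹ / 4) := by
    have h : (2 : ℝ) ^ (-(2 + classCost J 0)) = ((J : ℝ) ^ 3)⁻¹ / 4 / 256 := by
      have : -(2 + classCost J 0) = -(3 * Real.logb 2 J) + ((-10 : ℤ) : ℝ) := by
        simp only [classCost, if_true]
        push_cast
        ring
      rw [this, Real.rpow_add (by norm_num), rpow_neg_three_mul_logb hJ, Real.rpow_intCast]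
      norm_num
      ring
    rw [h]
    have h1 : ((classWords J 0).ncard : ℝ) ≤ 256 * J := by
      exact_mod_cast ncard_classWords_zero_le hJ
    calc _ ≤ 256 * (J : ℝ) * (((J : ℝ) ^ 3)⁻¹ / 4 / 256) := by gcongr
      _ = _ := by ring
  have e1 : ∑ s ∈ Finset.Icc 1 (L - 3),
      ((classWords J s).ncard : ℝ) * (2 : ℝ) ^ (-(2 + classCost J s)) ≤
        J * (((J : ℝ) ^ 3)⁻¹ / 4) := by
    calc _ ≤ ∑ s ∈ Finset.Icc 1 (L - 3), 4 * (2 : ℝ) ^ s * (((J : ℝ) ^ 3)⁻¹ / 4) := by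
          refine Finset.sum_le_sum fun s hs => ?_
          have hs0 : s ≠ 0 := by
            have := (Finset.mem_Icc.1 hs).1
            omega
          have h : (2 : ℝ) ^ (-(2 + classCost J s)) =
              (2 : ℝ) ^ (-(J * (1 / 2 : ℝ) ^ s)) * (((J : ℝ) ^ 3)⁻¹ / 4) := by
            have : -(2 + classCost J s) =
                -(J * (1 / 2 : ℝ) ^ s) + (-(3 * Real.logb 2 J) + ((-2 : ℤ) : ℝ)) := by
              simp only [classCost, hs0, if_false]
              push_cast
              ring
            rw [this, Real.rpow_add (by norm_num), Real.rpow_add (by norm_num),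
              rpow_neg_three_mul_logb hJ, Real.rpow_intCast]
            norm_num
            left
            ring
          rw [h, ← mul_assoc]
          exact mul_le_mul_of_nonneg_right (ncard_classWords_mul_le hs0) (by positivity)
      _ = (∑ s ∈ Finset.Icc 1 (L - 3), 4 * (2 : ℝ) ^ s) * (((J : ℝ) ^ 3)⁻¹ / 4) := by
          rw [Finset.sum_mul]
      _ ≤ J * (((J : ℝ) ^ 3)⁻¹ / 4) := by
          refine mul_le_mul_of_nonneg_right ?_ (by positivity)
          rcases Nat.lt_or_ge L 3 with h | h
          · rw [Finset.Icc_eq_empty (by omega)]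
            simp [hJ'.le]
          · have hsub : Finset.Icc 1 (L - 3) ⊆ Finset.range (L - 2) := by
              intro s hs
              have := (Finset.mem_Icc.1 hs).2
              exact Finset.mem_range.2 (by omega)
            calc _ ≤ ∑ s ∈ Finset.range (L - 2), 4 * (2 : ℝ) ^ s :=
                  Finset.sum_le_sum_of_subset_of_nonneg hsub fun _ _ _ => by positivity
              _ = 4 * ((2 : ℝ) ^ (L - 2) - 1) := by
                  rw [← Finset.mul_sum, geom_sum_eq (by norm_num)]
                  norm_num
              _ ≤ (2 : ℝ) ^ L := by
                  have : (2 : ℝ) ^ L = 4 * 2 ^ (L - 2) := by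
                    conv_lhs => rw [show L = (L - 2) + 2 by omega, pow_add]
                    ring
                  linarith
              _ ≤ J := hLJ
  rw [classes, Finset.sum_insert (by simp)]
  refine (add_le_add e0 e1).trans_eq ?_
  field_simp
  norm_num

/-- The code weight of a word of length `j + 1`. -/
def wordWeight (c : Σ j : ℕ, Fin (j + 1) → Bool) : ℝ :=
  ∑ s ∈ classes (c.1 + 1), (classWords (c.1 + 1) s).indicator
    (fun _ => (2 : ℝ) ^ (-(2 + classCost (c.1 + 1) s))) c.2

theorem wordWeight_nonneg (c : Σ j : ℕ, Fin (j + 1) → Bool) : 0 ≤ wordWeight c :=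
  Finset.sum_nonneg fun _ _ => Set.indicator_nonneg (fun _ _ => by positivity) _

theorem rpow_le_wordWeight {j s : ℕ} {v : Fin (j + 1) → Bool} (hs : s ∈ classes (j + 1))
    (hv : v ∈ classWords (j + 1) s) :
    (2 : ℝ) ^ (-(2 + classCost (j + 1) s)) ≤ wordWeight ⟨j, v⟩ := by
  refine le_trans (le_of_eq ?_) (Finset.single_le_sum
    (f := fun s => (classWords (j + 1) s).indicator
      (fun _ => (2 : ℝ) ^ (-(2 + classCost (j + 1) s))) v)
    (fun _ _ => Set.indicator_nonneg (fun _ _ => by positivity) _) hs)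
  exact (Set.indicator_of_mem hv (fun _ => (2 : ℝ) ^ (-(2 + classCost (j + 1) s)))).symm

/-- Kraft's inequality for the code weights of words. -/
theorem tsum_wordWeight_le : ∑' c, ENNReal.ofReal (wordWeight c) ≤ 1 := by
  classical
  rw [ENNReal.tsum_sigma']
  have h1 : ∀ j : ℕ, ∑' v : Fin (j + 1) → Bool, ENNReal.ofReal (wordWeight ⟨j, v⟩) ≤
      ENNReal.ofReal (1 / 2 * (1 / ((j + 1 : ℕ) : ℝ) ^ 2)) := by
    intro j
    rw [tsum_fintype, ← ENNReal.ofReal_sum_of_nonneg fun _ _ => wordWeight_nonneg _]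
    refine ENNReal.ofReal_le_ofReal ?_
    simp only [wordWeight]
    rw [Finset.sum_comm]
    calc _ = ∑ s ∈ classes (j + 1), ((classWords (j + 1) s).ncard : ℝ) *
          (2 : ℝ) ^ (-(2 + classCost (j + 1) s)) := by
          refine Finset.sum_congr rfl fun s _ => ?_
          rw [Finset.sum_indicator_eq_sum_filter, Finset.sum_const, nsmul_eq_mul,
            Set.ncard_eq_toFinset_card']
          congr 3
          ext v
          simp
      _ ≤ 1 / (2 * ((j + 1 : ℕ) : ℝ) ^ 2) := sum_classes_ncard_mul_le j.succ_pos
      _ = _ := by rw [one_div_mul_one_div]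
  refine (ENNReal.tsum_le_tsum h1).trans ?_
  have hz := (hasSum_nat_add_iff' 1).2 hasSum_zeta_two
  simp only [Finset.range_one, Finset.sum_singleton, Nat.cast_zero, ne_eq, OfNat.ofNat_ne_zero,
    not_false_eq_true, zero_pow, div_zero, sub_zero] at hz
  have hz' := hz.mul_left (1 / 2)
  rw [← ENNReal.ofReal_tsum_of_nonneg (fun _ => by positivity) hz'.summable, hz'.tsum_eq]
  rw [ENNReal.ofReal_le_one]
  nlinarith [Real.pi_lt_d2, Real.pi_pos]

/-! ### Cylinder sets -/

/-- Two points of the product shift agree on the window `[-m, m]`. -/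
def AgreeOn (m : ℕ) (p p' : Bin × Bin) : Prop :=
  ∀ i : ℤ, -(m : ℤ) ≤ i → i ≤ m → p.1 i = p'.1 i ∧ p.2 i = p'.2 i

theorem AgreeOn.symm {m : ℕ} {p p' : Bin × Bin} (h : AgreeOn m p p') : AgreeOn m p' p :=
  fun i h1 h2 => ⟨(h i h1 h2).1.symm, (h i h1 h2).2.symm⟩

theorem AgreeOn.mono {m n : ℕ} {p p' : Bin × Bin} (h : AgreeOn n p p') (hmn : m ≤ n) :
    AgreeOn m p p' :=
  fun i h1 h2 => h i (by omega) (by omega)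

theorem measurableSet_of_agreeOn {S : Set (Bin × Bin)} (m : ℕ)
    (hS : ∀ p p', AgreeOn m p p' → p ∈ S → p' ∈ S) : MeasurableSet S := by
  let r : Bin × Bin → (Set.Icc (-(m : ℤ)) m → Bool × Bool) := fun p i => (p.1 i, p.2 i)
  have hr : Measurable r := by
    refine measurable_pi_lambda _ fun i => ?_
    exact ((measurable_pi_apply _).comp measurable_fst).prodMk
      ((measurable_pi_apply _).comp measurable_snd)
  have h : S = r ⁻¹' (r '' S) := by
    refine Set.Subset.antisymm (Set.subset_preimage_image _ _) ?_
    rintro p' ⟨p, hp, hpp'⟩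
    refine hS p p' (fun i h1 h2 => ?_) hp
    have := congrFun hpp' ⟨i, h1, h2⟩
    exact Prod.ext_iff.1 this
  rw [h]
  exact hr (Set.toFinite _).measurableSet

/-- The algebra of sets that depend on finitely many coordinates. -/
def cylinderAlgebra : Set (Set (Bin × Bin)) :=
  {S | ∃ m, ∀ p p', AgreeOn m p p' → p ∈ S → p' ∈ S}

theorem isSetAlgebra_cylinderAlgebra : IsSetAlgebra cylinderAlgebra where
  empty_mem := ⟨0, fun _ _ _ h => h⟩
  compl_mem := by
    rintro S ⟨m, hm⟩
    exact ⟨m, fun p p' h hp hp' => hp (hm p' p h.symm hp')⟩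
  union_mem := by
    rintro S S' ⟨m, hm⟩ ⟨m', hm'⟩
    refine ⟨max m m', fun p p' h hp => ?_⟩
    rcases hp with hp | hp
    · exact Or.inl (hm p p' (h.mono (le_max_left _ _)) hp)
    · exact Or.inr (hm' p p' (h.mono (le_max_right _ _)) hp)

theorem generateFrom_cylinderAlgebra :
    (inferInstance : MeasurableSpace (Bin × Bin)) =
      MeasurableSpace.generateFrom cylinderAlgebra := by
  refine le_antisymm ?_ (MeasurableSpace.generateFrom_le ?_)
  · have h1 : ∀ i : ℤ, Measurable[MeasurableSpace.generateFrom cylinderAlgebra]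
        (fun p : Bin × Bin => p.1 i) := fun i s _ => by
      refine MeasurableSpace.measurableSet_generateFrom ⟨i.natAbs, fun p p' h hp => ?_⟩
      simpa [Set.mem_preimage, ← (h i (by omega) (by omega)).1] using hp
    have h2 : ∀ i : ℤ, Measurable[MeasurableSpace.generateFrom cylinderAlgebra]
        (fun p : Bin × Bin => p.2 i) := fun i s _ => by
      refine MeasurableSpace.measurableSet_generateFrom ⟨i.natAbs, fun p p' h hp => ?_⟩
      simpa [Set.mem_preimage, ← (h i (by omega) (by omega)).2] using hp
    exact sup_le
      (measurable_iff_comap_le.1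
        (@measurable_pi_lambda _ _ _ (MeasurableSpace.generateFrom cylinderAlgebra) _ _ h1))
      (measurable_iff_comap_le.1
        (@measurable_pi_lambda _ _ _ (MeasurableSpace.generateFrom cylinderAlgebra) _ _ h2))
  · rintro S ⟨m, hm⟩
    exact measurableSet_of_agreeOn m hm

/-- Finite-valued observables are approximated in measure by observables that depend on
finitely many coordinates. -/
theorem exists_cylinder_approx (ν : Measure (Bin × Bin)) [IsProbabilityMeasure ν] {k : ℕ}
    (f : Bin × Bin → Fin k) (hf : Measurable f) {η : ℝ} (hη : 0 < η) :
    ∃ (m : ℕ) (g : Bin × Bin → Fin k), (∀ p p', AgreeOn m p p' → g p = g p') ∧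
      ν {p | f p ≠ g p} ≤ ENNReal.ofReal η := by
  classical
  have hk : 0 < k := Fin.pos (f (fun _ => false, fun _ => false))
  have hk' : (0 : ℝ) < k := by exact_mod_cast hk
  have hdense := Measure.MeasureDense.of_generateFrom_isSetAlgebra_finite (μ := ν)
    isSetAlgebra_cylinderAlgebra generateFrom_cylinderAlgebra
  have happ : ∀ a : Fin k, ∃ t ∈ cylinderAlgebra,
      ν (symmDiff (f ⁻¹' {a}) t) < ENNReal.ofReal (η / k) := fun a =>
    hdense.approx _ (hf (measurableSet_singleton a)) (measure_ne_top _ _) _ (by positivity)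
  choose t ht hνt using happ
  choose m hm using ht
  refine ⟨Finset.univ.sup m, fun p => if h : ∃ a, p ∈ t a then h.choose else ⟨0, hk⟩, ?_, ?_⟩
  · intro p p' h
    have hiff : (fun a => p ∈ t a) = fun a => p' ∈ t a := by
      funext a
      have h' := h.mono (Finset.le_sup (f := m) (Finset.mem_univ a))
      exact propext ⟨hm a p p' h', hm a p' p h'.symm⟩
    simp only [hiff]
  · have hsub : {p | f p ≠ (if h : ∃ a, p ∈ t a then h.choose else ⟨0, hk⟩)} ⊆
        ⋃ a, symmDiff (f ⁻¹' {a}) (t a) := by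
      intro p hp
      by_contra hcon
      simp only [Set.mem_iUnion, not_exists] at hcon
      have hmem : ∀ a, p ∈ t a ↔ f p = a := by
        intro a
        have := hcon a
        rw [Set.mem_symmDiff] at this
        simp only [Set.mem_preimage, Set.mem_singleton_iff] at this
        tauto
      apply hp
      have hex : ∃ a, p ∈ t a := ⟨f p, (hmem _).2 rfl⟩
      rw [dif_pos hex]
      exact (hmem _).1 hex.choose_spec
    calc _ ≤ ν (⋃ a, symmDiff (f ⁻¹' {a}) (t a)) := measure_mono hsub
      _ ≤ ∑ a, ν (symmDiff (f ⁻¹' {a}) (t a)) := measure_iUnion_fintype_le _ _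
      _ ≤ ∑ _a : Fin k, ENNReal.ofReal (η / k) := Finset.sum_le_sum fun a _ => (hνt a).le
      _ = ENNReal.ofReal η := by
        rw [Finset.sum_const, Finset.card_univ, Fintype.card_fin, nsmul_eq_mul,
          ← ENNReal.ofReal_natCast, ← ENNReal.ofReal_mul (by positivity)]
        congr 1
        field_simp

/-! ### Returns to the pin set -/

theorem shift2_iterate_fst (p : Bin × Bin) (k : ℕ) (n : ℤ) :
    (shift2^[k] p).1 n = p.1 (n + k) := by
  induction k generalizing p with
  | zero => simp
  | succ k ih =>
    rw [Function.iterate_succ_apply, ih]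
    change p.1 (n + k + 1) = _
    rw [Nat.cast_succ, add_assoc]

theorem shift2_iterate_snd (p : Bin × Bin) (k : ℕ) (n : ℤ) :
    (shift2^[k] p).2 n = p.2 (n + k) := by
  induction k generalizing p with
  | zero => simp
  | succ k ih =>
    rw [Function.iterate_succ_apply, ih]
    change p.2 (n + k + 1) = _
    rw [Nat.cast_succ, add_assoc]

theorem segIn_shift2_iterate {p : Bin × Bin} {k : ℕ} {i j : ℤ} {Y : Set Bin} :
    SegIn (shift2^[k] p).1 i j Y ↔ SegIn p.1 (i + k) (j + k) Y := by
  constructor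
  · rintro ⟨y, hy, h⟩
    refine ⟨y, hy, fun m h1 h2 => ?_⟩
    have := h (m - k) (by omega) (by omega)
    rw [shift2_iterate_fst, sub_add_cancel] at this
    rw [← this]
    congr 1
    ring
  · rintro ⟨y, hy, h⟩
    refine ⟨y, hy, fun m h1 h2 => ?_⟩
    have := h (m + k) (by omega) (by omega)
    rw [shift2_iterate_fst, ← this]
    congr 1
    ring

theorem shift2_iterate_mem_PinSpace {p : Bin × Bin} (hp : p ∈ PinSpace) (k : ℕ) :
    shift2^[k] p ∈ PinSpace := by
  refine ⟨fun i j hij hz => ?_, fun i j hij hi hj => ?_⟩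
  · rw [segIn_shift2_iterate]
    refine hp.1 _ _ (by omega) fun n h1 h2 => ?_
    have := hz (n - k) (by omega) (by omega)
    rwa [shift2_iterate_snd, sub_add_cancel] at this
  · rw [segIn_shift2_iterate]
    rw [shift2_iterate_snd] at hi hj
    exact hp.2 _ _ (by omega) hi hj

theorem shift2_iterate_mem_Aset_iff {p : Bin × Bin} (hp : p ∈ Aset) (k : ℕ) :
    shift2^[k] p ∈ Aset ↔ p.2 k = true := by
  have : (shift2^[k] p).2 0 = p.2 k := by rw [shift2_iterate_snd, zero_add]
  exact ⟨fun h => this ▸ h.2, fun h => ⟨shift2_iterate_mem_PinSpace hp.1 k, this.trans h⟩⟩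

theorem retTime_eq_sInf {p : Bin × Bin} (hp : p ∈ Aset) :
    retTime p = sInf {k : ℕ | 1 ≤ k ∧ p.2 k = true} := by
  simp only [retTime, shift2_iterate_mem_Aset_iff hp]

theorem retTime_eq_zero_iff {p : Bin × Bin} (hp : p ∈ Aset) :
    retTime p = 0 ↔ ∀ k : ℕ, 1 ≤ k → p.2 k = false := by
  rw [retTime_eq_sInf hp, Nat.sInf_eq_zero]
  constructor
  · rintro (h | h) k hk
    · exact absurd h.1 (by norm_num)
    · by_contra hcon
      have : k ∈ {k : ℕ | 1 ≤ k ∧ p.2 k = true} := ⟨hk, by simpa using hcon⟩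
      rw [h] at this
      exact this
  · intro h
    right
    ext k
    simp only [Set.mem_ofPred_eq, Set.mem_empty_iff_false, iff_false, not_and, Bool.not_eq_true]
    exact h k

theorem retTime_eq_iff {p : Bin × Bin} (hp : p ∈ Aset) {j : ℕ} (hj : j ≠ 0) :
    retTime p = j ↔ p.2 j = true ∧ ∀ i : ℕ, 1 ≤ i → i < j → p.2 i = false := by
  rw [retTime_eq_sInf hp]
  constructor
  · intro h
    have hne : {k : ℕ | 1 ≤ k ∧ p.2 k = true}.Nonempty := by
      by_contra hcon
      rw [Set.not_nonempty_iff_eq_empty] at hcon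
      rw [hcon, Nat.sInf_empty] at h
      exact hj h.symm
    have hmem := Nat.sInf_mem hne
    rw [h] at hmem
    refine ⟨hmem.2, fun i hi hij => ?_⟩
    have := Nat.notMem_of_lt_sInf (h ▸ hij)
    simpa [hi] using this
  · rintro ⟨h1, h2⟩
    have hmem : j ∈ {k : ℕ | 1 ≤ k ∧ p.2 k = true} := ⟨by omega, h1⟩
    refine le_antisymm (Nat.sInf_le hmem) (le_csInf ⟨j, hmem⟩ ?_)
    rintro i ⟨hi, hi'⟩
    by_contra hcon
    rw [h2 i hi (by omega)] at hi'
    exact absurd hi' (by decide)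

theorem inducedMap_mem_Aset {p : Bin × Bin} (hp : p ∈ Aset) : inducedMap p ∈ Aset := by
  rw [inducedMap, shift2_iterate_mem_Aset_iff hp]
  by_cases h : retTime p = 0
  · rw [h]
    exact hp.2
  · exact ((retTime_eq_iff hp h).1 rfl).1

theorem inducedMap_iterate_mem_Aset {p : Bin × Bin} (hp : p ∈ Aset) (i : ℕ) :
    inducedMap^[i] p ∈ Aset := by
  induction i with
  | zero => exact hp
  | succ i ih =>
    rw [Function.iterate_succ_apply']
    exact inducedMap_mem_Aset ih

/-! ### Measurability -/

theorem measurableSet_Aset : MeasurableSet Aset := by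
  have h : Aset = (⋂ (i : ℤ) (j : ℤ), {p : Bin × Bin | i < j →
        (∀ k : ℤ, i < k → k ≤ j → p.2 k = false) → SegIn p.1 i j Yset}) ∩
      (⋂ (i : ℤ) (j : ℤ), {p : Bin × Bin | i < j → p.2 i = true → p.2 j = true →
        ¬ SegIn p.1 i j Yset}) ∩ {p | p.2 0 = true} := by
    ext p
    simp only [Aset, PinSpace, Set.mem_ofPred_eq, Set.mem_inter_iff, Set.mem_iInter]
  have hseg : ∀ {p p' : Bin × Bin} {i j : ℤ}, AgreeOn (i.natAbs + j.natAbs) p p' →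
      SegIn p.1 i j Yset → SegIn p'.1 i j Yset := by
    rintro p p' i j hpp' ⟨y, hy, h⟩
    exact ⟨y, hy, fun m h1 h2 => (h m h1 h2).trans (hpp' m (by omega) (by omega)).1⟩
  rw [h]
  refine ((MeasurableSet.iInter fun i => MeasurableSet.iInter fun j => ?_).inter
    (MeasurableSet.iInter fun i => MeasurableSet.iInter fun j => ?_)).inter ?_
  · refine measurableSet_of_agreeOn (i.natAbs + j.natAbs) fun p p' hpp' hp hij hz => ?_
    exact hseg hpp' (hp hij fun k h1 h2 =>
      (hpp' k (by omega) (by omega)).2.trans (hz k h1 h2))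
  · refine measurableSet_of_agreeOn (i.natAbs + j.natAbs) fun p p' hpp' hp hij hi hj hs => ?_
    exact hp hij ((hpp' i (by omega) (by omega)).2.trans hi)
      ((hpp' j (by omega) (by omega)).2.trans hj) (hseg hpp'.symm hs)
  · exact measurableSet_of_agreeOn 0 fun p p' hpp' hp =>
      ((hpp' 0 (by simp) (by simp)).2.symm.trans hp :)

theorem measurableSet_Qset (j : ℕ) : MeasurableSet (Qset j) := by
  by_cases hj : j = 0
  · have h : Qset j = Aset ∩ ⋂ k : ℕ, {p : Bin × Bin | 1 ≤ k → p.2 k = false} := by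
      ext p
      simp only [Qset, hj, Set.mem_ofPred_eq, Set.mem_inter_iff, Set.mem_iInter]
      exact and_congr_right fun hp => retTime_eq_zero_iff hp
    rw [h]
    refine measurableSet_Aset.inter (MeasurableSet.iInter fun k => ?_)
    exact measurableSet_of_agreeOn k fun p p' hpp' hp hk =>
      (hpp' k (by omega) (by omega)).2.symm.trans (hp hk)
  · have h : Qset j = Aset ∩ {p : Bin × Bin | p.2 j = true ∧
        ∀ i : ℕ, 1 ≤ i → i < j → p.2 i = false} := by
      ext p
      simp only [Qset, Set.mem_ofPred_eq, Set.mem_inter_iff]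
      exact and_congr_right fun hp => retTime_eq_iff hp hj
    rw [h]
    refine measurableSet_Aset.inter (measurableSet_of_agreeOn j fun p p' hpp' hp => ?_)
    exact ⟨(hpp' j (by omega) (by omega)).2.symm.trans hp.1, fun i h1 h2 =>
      (hpp' i (by omega) (by omega)).2.symm.trans (hp.2 i h1 h2)⟩

/-- The initial block of length `J`. -/
def initBlock (J : ℕ) (x : Bin) : Fin J → Bool := fun i => x ((i : ℕ) : ℤ)

theorem wordIn_iff_initBlock_mem {x : Bin} {J : ℕ} {Y : Set Bin} :
    WordIn x J Y ↔ initBlock J x ∈ langWord Y J :=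
  ⟨fun ⟨y, hy, h⟩ => ⟨y, hy, fun i => h i i.2⟩, fun ⟨y, hy, h⟩ => ⟨y, hy, fun m hm => h ⟨m, hm⟩⟩⟩

theorem mem_Qjs_iff {J s : ℕ} {p : Bin × Bin} :
    p ∈ Qjs J s ↔ p ∈ Qset J ∧ initBlock J p.1 ∈ classWords J s := by
  by_cases hs : s = 0 <;>
    simp only [Qjs, classWords, hs, if_true, if_false, Set.mem_ofPred_eq, wordIn_iff_initBlock_mem]

theorem measurableSet_Qjs (J s : ℕ) : MeasurableSet (Qjs J s) := by
  have h : Qjs J s = Qset J ∩ {p | initBlock J p.1 ∈ classWords J s} := by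
    ext p
    exact mem_Qjs_iff
  rw [h]
  refine (measurableSet_Qset J).inter (measurableSet_of_agreeOn J fun p p' hpp' hp => ?_)
  have : initBlock J p'.1 = initBlock J p.1 := by
    funext i
    exact (hpp' i (by omega) (by omega)).1.symm
  simpa only [Set.mem_ofPred_eq, this] using hp

/-! ### First-return blocks belong to some class -/

theorem exists_mem_Xsub_one (c : Bool) : ∃ y ∈ Xsub 1, y 0 = c := by
  refine ⟨fun n => if n % 2 = 0 then c else !c, subset_closure ?_, by simp⟩
  refine ⟨fun k => 2 * k, fun a b h => by simpa using h, fun N => ⟨|N| + 1, ?_⟩,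
    fun N => ⟨-|N| - 1, ?_⟩, fun k => ⟨[c, !c], ?_, ?_, fun i hi => ?_⟩⟩
  · have := le_abs_self N
    have := abs_nonneg N
    simp only
    omega
  · have := neg_abs_le N
    have := abs_nonneg N
    simp only
    omega
  · cases c <;> simp [genWords]
  · simp
    ring
  · simp only [List.length_cons, List.length_nil] at hi
    interval_cases i
    · simp
    · simp

theorem exists_class {j : ℕ} {p : Bin × Bin} (hp : p ∈ Qset (j + 1)) :
    ∃ s ∈ classes (j + 1), initBlock (j + 1) p.1 ∈ classWords (j + 1) s := by
  have hword : ∃ s, 1 ≤ s ∧ initBlock (j + 1) p.1 ∈ langWord (Xsub s) (j + 1) := by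
    rcases Nat.eq_zero_or_pos j with rfl | hj
    · obtain ⟨y, hy, h⟩ := exists_mem_Xsub_one (p.1 0)
      refine ⟨1, le_rfl, y, hy, fun i => ?_⟩
      have hi : i = 0 := Fin.ext (by omega)
      simpa [hi, initBlock] using h
    · have hret := ((retTime_eq_iff hp.1 j.succ_ne_zero).1 hp.2).2
      obtain ⟨y, hy, h⟩ := hp.1.1.1 0 j (by omega) fun k h1 h2 => by
        have := hret k.toNat (by omega) (by omega)
        rwa [Int.toNat_of_nonneg h1.le] at this
      obtain ⟨y', hy', h'⟩ := exists_agree_of_mem_closure hy (j + 1)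
      obtain ⟨n, hn⟩ := Set.mem_iUnion.1 hy'
      refine ⟨n + 1, by omega, y', hn, fun i => ?_⟩
      rw [h' i i.2]
      have := h i (by omega) (by omega)
      rwa [sub_zero] at this
  obtain ⟨s, hs, hw⟩ := hword
  by_cases h : s ≤ Nat.log 2 (j + 1) - 3
  · refine ⟨s, Finset.mem_insert_of_mem (Finset.mem_Icc.2 ⟨hs, h⟩), ?_⟩
    rwa [classWords, if_neg (by omega)]
  · refine ⟨0, Finset.mem_insert_self _ _, ?_⟩
    rw [classWords, if_pos rfl]
    exact ⟨s, hs, by omega, hw⟩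

/-! ### Recovering a point from its return blocks -/

/-- The word read by `p` until its first return. -/
def returnWord (p : Bin × Bin) : Σ j : ℕ, Fin (j + 1) → Bool :=
  ⟨retTime p - 1, initBlock _ p.1⟩

/-- The points that return to the pin set infinitely often. -/
def recurrentSet : Set (Bin × Bin) :=
  {p | p ∈ Aset ∧ ∀ i, retTime (inducedMap^[i] p) ≠ 0}

theorem inducedMap_iterate_mem_recurrentSet {p : Bin × Bin} (hp : p ∈ recurrentSet) (i : ℕ) :
    inducedMap^[i] p ∈ recurrentSet :=
  ⟨inducedMap_iterate_mem_Aset hp.1 i, fun n => by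
    rw [← Function.iterate_add_apply]
    exact hp.2 _⟩

/-- The time of the `i`-th return. -/
def returnSum (p : Bin × Bin) : ℕ → ℕ
  | 0 => 0
  | i + 1 => returnSum p i + retTime (inducedMap^[i] p)

theorem inducedMap_iterate_eq (p : Bin × Bin) (i : ℕ) :
    inducedMap^[i] p = shift2^[returnSum p i] p := by
  induction i with
  | zero => rfl
  | succ i ih =>
    rw [Function.iterate_succ_apply', returnSum, add_comm, Function.iterate_add_apply, ← ih]
    rfl

theorem returnSum_add_le {p : Bin × Bin} (hp : p ∈ recurrentSet) (i n : ℕ) :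
    returnSum p i + n ≤ returnSum p (i + n) := by
  induction n with
  | zero => rfl
  | succ n ih =>
    have := hp.2 (i + n)
    rw [← add_assoc i n 1, returnSum]
    omega

theorem agree_of_returnWord_eq {p p' : Bin × Bin} (hp : p ∈ Aset) (hp' : p' ∈ Aset)
    (hr : retTime p ≠ 0) (hr' : retTime p' ≠ 0) (h : returnWord p = returnWord p') :
    retTime p = retTime p' ∧
      ∀ n : ℕ, n < retTime p → p.1 n = p'.1 n ∧ p.2 n = p'.2 n := by
  have h1 : retTime p = retTime p' := by
    have := congrArg Sigma.fst h
    simp only [returnWord] at this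
    omega
  refine ⟨h1, fun n hn => ⟨?_, ?_⟩⟩
  · have e : ∀ q, n < retTime q → (fun c : Σ j : ℕ, Fin (j + 1) → Bool =>
        if hc : n < c.1 + 1 then c.2 ⟨n, hc⟩ else false) (returnWord q) = q.1 n :=
      fun q hq => dif_pos (show n < retTime q - 1 + 1 by omega)
    rw [← e p hn, ← e p' (h1 ▸ hn), h]
  · rcases Nat.eq_zero_or_pos n with rfl | hn0
    · exact hp.2.trans hp'.2.symm
    · rw [((retTime_eq_iff hp hr).1 rfl).2 n hn0 hn,
        ((retTime_eq_iff hp' hr').1 rfl).2 n hn0 (h1 ▸ hn)]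

theorem agree_of_returnWords_eq {p p' : Bin × Bin} (hp : p ∈ recurrentSet)
    (hp' : p' ∈ recurrentSet) (M : ℕ)
    (h : ∀ i < M, returnWord (inducedMap^[i] p) = returnWord (inducedMap^[i] p')) :
    (∀ i ≤ M, returnSum p i = returnSum p' i) ∧
      ∀ n : ℕ, n < returnSum p M → p.1 n = p'.1 n ∧ p.2 n = p'.2 n := by
  induction M with
  | zero =>
    refine ⟨fun i hi => ?_, fun n hn => absurd hn (Nat.not_lt_zero n)⟩
    obtain rfl : i = 0 := by omega
    rfl
  | succ M ih =>
    obtain ⟨ih1, ih2⟩ := ih fun i hi => h i (by omega)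
    obtain ⟨h1, h2⟩ := agree_of_returnWord_eq (inducedMap_iterate_mem_Aset hp.1 M)
      (inducedMap_iterate_mem_Aset hp'.1 M) (hp.2 M) (hp'.2 M) (h M (by omega))
    refine ⟨fun i hi => ?_, fun n hn => ?_⟩
    · rcases Nat.lt_or_ge i (M + 1) with hi' | hi'
      · exact ih1 i (by omega)
      · obtain rfl : i = M + 1 := by omega
        rw [returnSum, returnSum, ih1 M le_rfl, h1]
    · rcases Nat.lt_or_ge n (returnSum p M) with hn' | hn'
      · exact ih2 n hn'
      · rw [returnSum] at hn
        have h3 := h2 (n - returnSum p M) (by omega)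
        rw [inducedMap_iterate_eq p, inducedMap_iterate_eq p', ← ih1 M le_rfl,
          shift2_iterate_fst, shift2_iterate_fst, shift2_iterate_snd, shift2_iterate_snd] at h3
        have h4 : ((n - returnSum p M : ℕ) : ℤ) + (returnSum p M : ℕ) = n := by omega
        rwa [h4] at h3

/-- The first `2 m + 1` return words of a recurrent point `p` determine the coordinates of its
`m`-th return point in the window `[-m, m]`. -/
theorem agreeOn_of_returnWords_eq {p p' : Bin × Bin} (hp : p ∈ recurrentSet)
    (hp' : p' ∈ recurrentSet) (m : ℕ)
    (h : ∀ i < 2 * m + 1, returnWord (inducedMap^[i] p) = returnWord (inducedMap^[i] p')) :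
    AgreeOn m (inducedMap^[m] p) (inducedMap^[m] p') := by
  obtain ⟨h1, h2⟩ := agree_of_returnWords_eq hp hp' _ h
  intro i hi1 hi2
  have hm := returnSum_add_le hp 0 m
  have hm' := returnSum_add_le hp m (m + 1)
  rw [zero_add, returnSum, zero_add] at hm
  rw [show m + (m + 1) = 2 * m + 1 by ring] at hm'
  have h3 := h2 (i + returnSum p m).toNat (by omega)
  rw [Int.toNat_of_nonneg (by omega)] at h3
  rw [inducedMap_iterate_eq p, inducedMap_iterate_eq p', ← h1 m (by omega),
    shift2_iterate_fst, shift2_iterate_fst, shift2_iterate_snd, shift2_iterate_snd]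
  exact h3

/-! ### Entropy of the induced map -/

/-- The expected excess code length of the first return word, classwise. -/
def excessCost (p : Bin × Bin) : ENNReal :=
  ∑' j : ℕ, ∑ s ∈ classes (j + 1),
    (Qjs (j + 1) s).indicator (fun _ => ENNReal.ofReal (classCost (j + 1) s)) p

theorem measurable_excessCost : Measurable excessCost :=
  Measurable.tsum fun _ => Finset.measurable_fun_sum _ fun _ _ =>
    measurable_const.indicator (measurableSet_Qjs _ _)

theorem lintegral_excessCost (ν : Measure (Bin × Bin)) [IsProbabilityMeasure ν] :
    ∫⁻ p, excessCost p ∂ν = ∑' j : ℕ, ∑ s ∈ classes (j + 1),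
      ENNReal.ofReal ((ν (Qjs (j + 1) s)).toReal * classCost (j + 1) s) := by
  simp only [excessCost]
  rw [lintegral_tsum fun _ => (Finset.measurable_fun_sum _ fun _ _ =>
    measurable_const.indicator (measurableSet_Qjs _ _)).aemeasurable]
  refine tsum_congr fun j => ?_
  rw [lintegral_finsetSum _ fun _ _ => measurable_const.indicator (measurableSet_Qjs _ _)]
  refine Finset.sum_congr rfl fun s _ => ?_
  rw [lintegral_indicator_const (measurableSet_Qjs _ _), ENNReal.ofReal_mul ENNReal.toReal_nonneg,
    ENNReal.ofReal_toReal (measure_ne_top _ _), mul_comm]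

theorem wordWeight_returnWord {p : Bin × Bin} (hp : p ∈ Aset) (hr : retTime p ≠ 0) :
    0 < wordWeight (returnWord p) ∧
      ENNReal.ofReal (-Real.logb 2 (wordWeight (returnWord p))) ≤ 2 + excessCost p := by
  obtain ⟨j, hj⟩ := Nat.exists_eq_succ_of_ne_zero hr
  have hQ : p ∈ Qset (j + 1) := ⟨hp, hj⟩
  obtain ⟨s, hs, hw⟩ := exists_class hQ
  have hword : returnWord p = ⟨j, initBlock (j + 1) p.1⟩ := by
    have : retTime p - 1 = j := by omega
    rw [returnWord, this]
  have hle := rpow_le_wordWeight hs hw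
  rw [hword]
  have hpos : (0 : ℝ) < (2 : ℝ) ^ (-(2 + classCost (j + 1) s)) := by positivity
  refine ⟨hpos.trans_le hle, ?_⟩
  have hlog := Real.logb_le_logb_of_le (by norm_num : (1 : ℝ) < 2) hpos hle
  rw [Real.logb_rpow (by norm_num) (by norm_num)] at hlog
  calc _ ≤ ENNReal.ofReal (2 + classCost (j + 1) s) := ENNReal.ofReal_le_ofReal (by linarith)
    _ = 2 + ENNReal.ofReal (classCost (j + 1) s) := by
      rw [ENNReal.ofReal_add (by norm_num) (classCost_nonneg j.succ_pos s)]
      norm_num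
    _ ≤ 2 + excessCost p := by
      gcongr
      refine le_trans ?_ (ENNReal.le_tsum j)
      refine le_trans (le_of_eq ?_) (Finset.single_le_sum
        (f := fun s => (Qjs (j + 1) s).indicator
          (fun _ => ENNReal.ofReal (classCost (j + 1) s)) p) (fun _ _ => zero_le) hs)
      exact (Set.indicator_of_mem (mem_Qjs_iff.2 ⟨hQ, hw⟩)
        (fun _ => ENNReal.ofReal (classCost (j + 1) s))).symm

theorem inducedMap_iterate_of_retTime_eq_zero {p : Bin × Bin} (hr : retTime p = 0) (i : ℕ) :
    inducedMap^[i] p = p :=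
  Function.iterate_fixed (by rw [inducedMap, hr]; rfl) i

/-- Almost every point either never returns or returns infinitely often. -/
theorem ae_mem_recurrentSet_or {ν : Measure (Bin × Bin)} [IsProbabilityMeasure ν]
    (hA : ν Aset = 1) (hinv : MeasurePreserving inducedMap ν ν) :
    ∀ᵐ p ∂ν, p ∈ recurrentSet ∪ Qset 0 := by
  have hAae : ∀ᵐ p ∂ν, p ∈ Aset := (prob_compl_eq_zero_iff measurableSet_Aset).2 hA
  have hnull : ∀ i : ℕ, ∀ᵐ p ∂ν, p ∉ (inducedMap^[i] ⁻¹' Qset 0) \ Qset 0 := by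
    intro i
    have hi := hinv.iterate i
    have hsub : Qset 0 ⊆ inducedMap^[i] ⁻¹' Qset 0 := by
      intro p hp
      rw [Set.mem_preimage, inducedMap_iterate_of_retTime_eq_zero hp.2]
      exact hp
    rw [← measure_eq_zero_iff_ae_notMem, measure_sdiff hsub
      (measurableSet_Qset 0).nullMeasurableSet (measure_ne_top _ _),
      hi.measure_preimage (measurableSet_Qset 0).nullMeasurableSet, tsub_self]
  filter_upwards [hAae, ae_all_iff.2 hnull] with p hp hpn
  by_cases h : p ∈ Qset 0
  · exact Or.inr h
  · exact Or.inl ⟨hp, fun i hi => hpn i ⟨⟨inducedMap_iterate_mem_Aset hp i, hi⟩, h⟩⟩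

/-- The code weight of an approximation error: `none` (no error) is cheap. -/
def errorWeight (k : ℕ) (ε : ℝ) : Option (Fin k) → ℝ
  | none => (2 : ℝ) ^ (-ε)
  | some _ => (1 - (2 : ℝ) ^ (-ε)) / k

theorem errorWeight_pos {k : ℕ} (hk : 0 < k) {ε : ℝ} (hε : 0 < ε) (e : Option (Fin k)) :
    0 < errorWeight k ε e := by
  have h : (2 : ℝ) ^ (-ε) < 1 := Real.rpow_lt_one_of_one_lt_of_neg (by norm_num) (by linarith)
  have hk' : (0 : ℝ) < k := by exact_mod_cast hk
  cases e with
  | none => exact Real.rpow_pos_of_pos (by norm_num) _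
  | some a => exact div_pos (by linarith) hk'

theorem tsum_errorWeight_le {k : ℕ} (hk : 0 < k) {ε : ℝ} (hε : 0 < ε) :
    ∑' e, ENNReal.ofReal (errorWeight k ε e) ≤ 1 := by
  have hk' : (k : ℝ) ≠ 0 := by exact_mod_cast hk.ne'
  rw [tsum_fintype, ← ENNReal.ofReal_sum_of_nonneg fun e _ => (errorWeight_pos hk hε e).le,
    ENNReal.ofReal_le_one, Fintype.sum_option]
  simp only [errorWeight, Finset.sum_const, Finset.card_univ, Fintype.card_fin, nsmul_eq_mul]
  rw [mul_div_cancel₀ _ hk']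
  linarith

/-- The total weight on codes: either a symbol (for points that never return), or a sequence of
return words together with a sequence of approximation errors. -/
def codeWeight (k M n : ℕ) (ε : ℝ) :
    Fin k ⊕ ((Fin M → Σ j : ℕ, Fin (j + 1) → Bool) × (Fin n → Option (Fin k))) → ℝ
  | Sum.inl _ => 1 / (2 * k)
  | Sum.inr c => 1 / 2 * ((∏ i, wordWeight (c.1 i)) * ∏ i, errorWeight k ε (c.2 i))

theorem tsum_codeWeight_le {k : ℕ} (hk : 0 < k) (M n : ℕ) {ε : ℝ} (hε : 0 < ε) :
    ∑' c, ENNReal.ofReal (codeWeight k M n ε c) ≤ 1 := by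
  have hk' : (k : ℝ) ≠ 0 := by exact_mod_cast hk.ne'
  rw [ENNReal.summable.tsum_sum ENNReal.summable]
  have h1 : ∑' a : Fin k, ENNReal.ofReal (codeWeight k M n ε (Sum.inl a)) =
      ENNReal.ofReal (1 / 2) := by
    simp only [codeWeight]
    rw [tsum_fintype, Finset.sum_const, Finset.card_univ, Fintype.card_fin, nsmul_eq_mul,
      ← ENNReal.ofReal_natCast, ← ENNReal.ofReal_mul (by positivity)]
    congr 1
    field_simp
  have h2 : ∑' c, ENNReal.ofReal (codeWeight k M n ε (Sum.inr c)) ≤ ENNReal.ofReal (1 / 2) := by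
    have h : ∀ c, ENNReal.ofReal (codeWeight k M n ε (Sum.inr c)) = ENNReal.ofReal (1 / 2) *
        ((∏ i, ENNReal.ofReal (wordWeight (c.1 i))) *
          ∏ i, ENNReal.ofReal (errorWeight k ε (c.2 i))) := by
      intro c
      have hw : 0 ≤ ∏ i, wordWeight (c.1 i) := Finset.prod_nonneg fun _ _ => wordWeight_nonneg _
      simp only [codeWeight]
      rw [ENNReal.ofReal_mul (by norm_num), ENNReal.ofReal_mul hw,
        ENNReal.ofReal_prod_of_nonneg fun _ _ => wordWeight_nonneg _,
        ENNReal.ofReal_prod_of_nonneg fun _ _ => (errorWeight_pos hk hε _).le]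
    simp_rw [h]
    rw [ENNReal.tsum_mul_left, ENNReal.tsum_prod']
    simp_rw [ENNReal.tsum_mul_left, ENNReal.tsum_mul_right]
    rw [tsum_pi_prod (fun c => ENNReal.ofReal (wordWeight c)),
      tsum_pi_prod (fun e => ENNReal.ofReal (errorWeight k ε e))]
    refine mul_le_of_le_one_right' ?_
    exact mul_le_one' (pow_le_one' tsum_wordWeight_le _) (pow_le_one' (tsum_errorWeight_le hk hε) _)
  rw [h1]
  refine (add_le_add_right h2 _).trans_eq ?_
  rw [← ENNReal.ofReal_add (by norm_num) (by norm_num)]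
  norm_num

theorem ofReal_neg_logb_prod_le {n : ℕ} (w : Fin n → ℝ) (hw : ∀ i, 0 < w i) :
    ENNReal.ofReal (-Real.logb 2 (∏ i, w i)) ≤ ∑ i, ENNReal.ofReal (-Real.logb 2 (w i)) := by
  rw [Real.logb_prod _ _ fun i _ => (hw i).ne', ← Finset.sum_neg_distrib]
  exact Finset.le_sum_of_subadditive ENNReal.ofReal ENNReal.ofReal_zero.le
    (fun _ _ => ENNReal.ofReal_add_le) _ _

/-- The error committed when `f` is approximated by `g`: the correct value, if it is not `g`. -/
def approxError {k : ℕ} (f g : Bin × Bin → Fin k) (p : Bin × Bin) : Option (Fin k) :=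
  if f p = g p then none else some (f p)

theorem getD_approxError {k : ℕ} (f g : Bin × Bin → Fin k) (p : Bin × Bin) :
    (approxError f g p).getD (g p) = f p := by
  by_cases h : f p = g p
  · simp [approxError, h]
  · simp [approxError, h]

/-- The code length of the approximation error. -/
def errorCost {k : ℕ} (ε : ℝ) (f g : Bin × Bin → Fin k) (p : Bin × Bin) : ENNReal :=
  ENNReal.ofReal (-Real.logb 2 (errorWeight k ε (approxError f g p)))

theorem measurable_errorCost {k : ℕ} (ε : ℝ) {f g : Bin × Bin → Fin k} (hf : Measurable f)
    (hg : Measurable g) : Measurable (errorCost ε f g) := by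
  have h : errorCost ε f g = fun p => if f p = g p then
      ENNReal.ofReal (-Real.logb 2 (errorWeight k ε none)) else
      ENNReal.ofReal (-Real.logb 2 (errorWeight k ε (some (f p)))) := by
    funext p
    rw [errorCost, approxError]
    split_ifs <;> rfl
  rw [h]
  exact Measurable.ite (measurableSet_eq_fun hf hg) measurable_const
    ((measurable_of_countable fun a : Fin k =>
      ENNReal.ofReal (-Real.logb 2 (errorWeight k ε (some a)))).comp hf)

theorem lintegral_errorCost_le (ν : Measure (Bin × Bin)) [IsProbabilityMeasure ν] {k : ℕ}
    {ε η : ℝ} (hε : 0 < ε) (hη : 0 ≤ η) {f g : Bin × Bin → Fin k} (hf : Measurable f)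
    (hg : Measurable g) (hfg : ν {p | f p ≠ g p} ≤ ENNReal.ofReal η)
    (hηε : -Real.logb 2 ((1 - (2 : ℝ) ^ (-ε)) / k) * η ≤ ε) :
    ∫⁻ p, errorCost ε f g p ∂ν ≤ ENNReal.ofReal (2 * ε) := by
  set κ := -Real.logb 2 ((1 - (2 : ℝ) ^ (-ε)) / k)
  have hS : MeasurableSet {p | f p ≠ g p} := (measurableSet_eq_fun hf hg).compl
  calc ∫⁻ p, errorCost ε f g p ∂ν
      ≤ ∫⁻ p, (ENNReal.ofReal ε +
          {p | f p ≠ g p}.indicator (fun _ => ENNReal.ofReal κ) p) ∂ν := by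
        refine lintegral_mono fun p => ?_
        by_cases h : f p = g p
        · refine le_trans (le_of_eq ?_) le_self_add
          simp only [errorCost, approxError, h, if_true, errorWeight]
          rw [Real.logb_rpow (by norm_num) (by norm_num), neg_neg]
        · have hp : p ∈ {p | f p ≠ g p} := h
          rw [Set.indicator_of_mem hp]
          refine le_trans (le_of_eq ?_) le_add_self
          simp only [errorCost, approxError, h, if_false, errorWeight, κ]
    _ = ENNReal.ofReal ε + ENNReal.ofReal κ * ν {p | f p ≠ g p} := by
        rw [lintegral_add_left measurable_const, lintegral_const, measure_univ, mul_one,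
          lintegral_indicator_const hS]
    _ ≤ ENNReal.ofReal ε + ENNReal.ofReal (κ * η) := by
        rw [ENNReal.ofReal_mul' hη]
        gcongr
    _ ≤ ENNReal.ofReal (2 * ε) := by
        rw [two_mul, ENNReal.ofReal_add hε.le hε.le]
        gcongr

/-- The entropy of a long observation is at most the expected length of the code which records the
return words and the approximation errors. -/
theorem ofReal_entOfObs_iterate_le {ν : Measure (Bin × Bin)} [IsProbabilityMeasure ν]
    (hA : ν Aset = 1) (hinv : MeasurePreserving inducedMap ν ν) {k : ℕ} (hk : 0 < k)
    {f g : Bin × Bin → Fin k} (hf : Measurable f) (hgm : Measurable g) {m : ℕ}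
    (hg : ∀ p p', AgreeOn m p p' → g p = g p') {ε : ℝ} (hε : 0 < ε) (n : ℕ) :
    ENNReal.ofReal (entOfObs ν fun x => fun i : Fin (n + 1) => f (inducedMap^[(i : ℕ)] x)) ≤
      ENNReal.ofReal (Real.logb 2 (2 * k)) +
        (n + 1 + 2 * m : ℕ) * (2 + ∫⁻ p, excessCost p ∂ν) +
        (n + 1 : ℕ) * ∫⁻ p, errorCost ε f g p ∂ν := by
  classical
  set F : Bin × Bin → Fin (n + 1) → Fin k := fun x i => f (inducedMap^[(i : ℕ)] x) with hF
  have hFm : ∀ S : ℕ, Measurable fun x => F (inducedMap^[S] x) := fun S =>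
    measurable_pi_lambda _ fun i => hf.comp
      ((hinv.iterate (i : ℕ)).measurable.comp (hinv.iterate S).measurable)
  have hk' : (1 : ℝ) ≤ k := by exact_mod_cast hk
  rw [← entOfObs_comp (hinv.iterate m) F fun a => hFm 0 (measurableSet_singleton a)]
  let C : Bin × Bin → Fin k ⊕ ((Fin (n + 1 + 2 * m) → Σ j : ℕ, Fin (j + 1) → Bool) ×
      (Fin (n + 1) → Option (Fin k))) := fun p =>
    if p ∈ Qset 0 then Sum.inl (f p) else
      Sum.inr (fun i => returnWord (inducedMap^[(i : ℕ)] p),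
        fun i => approxError f g (inducedMap^[(i : ℕ) + m] p))
  have hnot : ∀ p ∈ recurrentSet ∪ Qset 0, p ∉ Qset 0 → p ∈ recurrentSet := fun p hp h =>
    hp.resolve_right h
  have hret : ∀ p ∈ recurrentSet, ∀ i : ℕ,
      0 < wordWeight (returnWord (inducedMap^[i] p)) ∧
        ENNReal.ofReal (-Real.logb 2 (wordWeight (returnWord (inducedMap^[i] p)))) ≤
          2 + excessCost (inducedMap^[i] p) := fun p hp i =>
    wordWeight_returnWord (inducedMap_iterate_mem_Aset hp.1 i) (hp.2 i)
  have hFapply : ∀ p (i : Fin (n + 1)), F (inducedMap^[m] p) i = f (inducedMap^[(i : ℕ) + m] p) :=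
    fun p i => by rw [hF, Function.iterate_add_apply]
  refine (entOfObs_le_lintegral_of_code ν _ (fun a => hFm m (measurableSet_singleton a))
    (recurrentSet ∪ Qset 0) (ae_mem_recurrentSet_or hA hinv) C
    (codeWeight k (n + 1 + 2 * m) (n + 1) ε) (tsum_codeWeight_le hk _ _ hε) ?_ ?_
    (fun p => ENNReal.ofReal (Real.logb 2 (2 * k)) +
      ∑ i : Fin (n + 1 + 2 * m), (2 + excessCost (inducedMap^[(i : ℕ)] p)) +
      ∑ i : Fin (n + 1), errorCost ε f g (inducedMap^[(i : ℕ) + m] p)) ?_).trans_eq ?_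
  · intro p hp p' hp' hC
    funext i
    rw [hFapply, hFapply]
    by_cases h : p ∈ Qset 0 <;> by_cases h' : p' ∈ Qset 0
    · simp only [C, h, h', if_true, Sum.inl.injEq] at hC
      rwa [inducedMap_iterate_of_retTime_eq_zero h.2, inducedMap_iterate_of_retTime_eq_zero h'.2]
    · simp [C, h, h'] at hC
    · simp [C, h, h'] at hC
    · simp only [C, h, h', if_false, Sum.inr.injEq, Prod.mk.injEq] at hC
      have hr := inducedMap_iterate_mem_recurrentSet (hnot p hp h) i
      have hr' := inducedMap_iterate_mem_recurrentSet (hnot p' hp' h') i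
      have hagree := agreeOn_of_returnWords_eq hr hr' m fun l hl => by
        have := congrFun hC.1 ⟨l + i, by omega⟩
        simpa only [Function.iterate_add_apply] using this
      simp only [← Function.iterate_add_apply, add_comm m] at hagree
      rw [← getD_approxError f g, ← getD_approxError f g (inducedMap^[(i : ℕ) + m] p'),
        hg _ _ hagree, congrFun hC.2 i]
  · intro p hp
    by_cases h : p ∈ Qset 0
    · simp only [C, h, if_true, codeWeight]
      positivity
    · simp only [C, h, if_false, codeWeight]
      have h1 := Finset.prod_pos fun (i : Fin (n + 1 + 2 * m)) (_ : i ∈ Finset.univ) =>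
        (hret p (hnot p hp h) (i : ℕ)).1
      have h2 := Finset.prod_pos fun (i : Fin (n + 1)) (_ : i ∈ Finset.univ) =>
        errorWeight_pos hk hε (approxError f g (inducedMap^[(i : ℕ) + m] p))
      positivity
  · intro p hp
    by_cases h : p ∈ Qset 0
    · simp only [C, h, if_true, codeWeight]
      rw [one_div, Real.logb_inv, neg_neg, add_assoc]
      exact le_self_add
    · simp only [C, h, if_false, codeWeight]
      have hpos := fun i : Fin (n + 1 + 2 * m) => (hret p (hnot p hp h) (i : ℕ)).1
      have hpos' := fun i : Fin (n + 1) =>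
        errorWeight_pos hk hε (approxError f g (inducedMap^[(i : ℕ) + m] p))
      have h1 := Finset.prod_pos fun i (_ : i ∈ Finset.univ) => hpos i
      have h2 := Finset.prod_pos fun i (_ : i ∈ Finset.univ) => hpos' i
      rw [Real.logb_mul (by norm_num) (mul_pos h1 h2).ne', Real.logb_mul h1.ne' h2.ne', neg_add,
        neg_add, ← add_assoc]
      refine ENNReal.ofReal_add_le.trans (add_le_add (ENNReal.ofReal_add_le.trans
        (add_le_add ?_ ?_)) ?_)
      · refine ENNReal.ofReal_le_ofReal ?_
        rw [one_div, Real.logb_inv, neg_neg]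
        exact Real.logb_le_logb_of_le (by norm_num) (by norm_num) (by linarith)
      · exact (ofReal_neg_logb_prod_le _ hpos).trans
          (Finset.sum_le_sum fun i _ => (hret p (hnot p hp h) (i : ℕ)).2)
      · exact ofReal_neg_logb_prod_le _ hpos'
  · have hm1 : ∀ i : ℕ, Measurable fun p => 2 + excessCost (inducedMap^[i] p) := fun i =>
      measurable_const.add (measurable_excessCost.comp (hinv.iterate i).measurable)
    have hm2 : ∀ i : ℕ, Measurable fun p => errorCost ε f g (inducedMap^[i] p) := fun i =>
      (measurable_errorCost ε hf hgm).comp (hinv.iterate i).measurable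
    rw [lintegral_add_right _ (Finset.measurable_fun_sum _ fun i _ => hm2 _),
      lintegral_add_left measurable_const, lintegral_finsetSum _ fun i _ => hm1 _,
      lintegral_finsetSum _ fun i _ => hm2 _]
    have e1 : ∀ i : ℕ, ∫⁻ p, (2 + excessCost (inducedMap^[i] p)) ∂ν =
        2 + ∫⁻ p, excessCost p ∂ν := fun i => by
      rw [lintegral_add_left measurable_const, lintegral_const, measure_univ, mul_one,
        (hinv.iterate i).lintegral_comp measurable_excessCost]
    have e2 : ∀ i : ℕ, ∫⁻ p, errorCost ε f g (inducedMap^[i] p) ∂ν =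
        ∫⁻ p, errorCost ε f g p ∂ν := fun i =>
      (hinv.iterate i).lintegral_comp (measurable_errorCost ε hf hgm)
    simp only [e1, e2, lintegral_const, measure_univ, mul_one, Finset.sum_const, Finset.card_univ,
      Fintype.card_fin, nsmul_eq_mul]

theorem entOfObs_nonneg {X F : Type*} [MeasurableSpace X] [Fintype F] (ν : Measure X)
    [IsProbabilityMeasure ν] (f : X → F) : 0 ≤ entOfObs ν f := by
  refine Finset.sum_nonneg fun a _ => ?_
  have h1 : (ν (f ⁻¹' {a})).toReal ≤ 1 := by
    simpa using ENNReal.toReal_mono ENNReal.one_ne_top (prob_le_one (μ := ν) (s := f ⁻¹' {a}))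
  rw [← mul_neg]
  exact mul_nonneg ENNReal.toReal_nonneg
    (neg_nonneg.2 (Real.logb_nonpos (by norm_num) ENNReal.toReal_nonneg h1))

theorem entObsT_le_of_forall {X F : Type*} [MeasurableSpace X] [Fintype F] (T : X → X)
    (ν : Measure X) [IsProbabilityMeasure ν] (f : X → F) {a b : ℝ}
    (h : ∀ n : ℕ, entOfObs ν (fun x => fun i : Fin (n + 1) => f (T^[(i : ℕ)] x)) ≤
      a + (n + 1) * b) : entObsT T ν f ≤ b := by
  have hlim : Tendsto (fun n : ℕ => a * (1 / ((n : ℝ) + 1)) + b) atTop (𝓝 (a * 0 + b)) :=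
    (tendsto_one_div_add_atTop_nhds_zero_nat.const_mul a).add_const b
  rw [mul_zero, zero_add] at hlim
  refine ge_of_tendsto' hlim fun n => ?_
  have hn : (0 : ℝ) < n + 1 := by positivity
  refine (ciInf_le ⟨0, ?_⟩ n).trans ?_
  · rintro _ ⟨n, rfl⟩
    exact div_nonneg (entOfObs_nonneg ν _) (by positivity)
  · rw [div_le_iff₀ hn]
    refine (h n).trans_eq ?_
    field_simp

theorem entObsT_inducedMap_le {ν : Measure (Bin × Bin)} [IsProbabilityMeasure ν]
    (hA : ν Aset = 1) (hinv : MeasurePreserving inducedMap ν ν) {r : ℝ} (hr : 0 ≤ r)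
    (hR : 2 + ∫⁻ p, excessCost p ∂ν = ENNReal.ofReal r) {k : ℕ} {f : Bin × Bin → Fin k}
    (hf : Measurable f) : entObsT inducedMap ν f ≤ r := by
  have hk : 0 < k := Fin.pos (f (fun _ => false, fun _ => false))
  refine le_of_forall_pos_le_add fun δ hδ => ?_
  obtain ⟨ε, hε, rfl⟩ : ∃ ε : ℝ, 0 < ε ∧ δ = 2 * ε := ⟨δ / 2, by positivity, by ring⟩
  set κ := -Real.logb 2 ((1 - (2 : ℝ) ^ (-ε)) / k)
  have hκ : 0 < |κ| + 1 := by positivity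
  have hη : 0 < ε / (|κ| + 1) := by positivity
  have hηε : κ * (ε / (|κ| + 1)) ≤ ε := by
    rw [mul_div_assoc', div_le_iff₀ hκ, mul_comm]
    exact mul_le_mul_of_nonneg_left ((le_abs_self κ).trans (by linarith)) hε.le
  obtain ⟨m, g, hg, hfg⟩ := exists_cylinder_approx ν f hf hη
  have hgm : Measurable g := measurable_to_countable' fun a =>
    measurableSet_of_agreeOn m fun p p' hpp' hp => (hg p p' hpp').symm.trans hp
  refine entObsT_le_of_forall (a := Real.logb 2 (2 * k) + (2 * m) * r) _ _ _ fun n => ?_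
  have hlog : 0 ≤ Real.logb 2 (2 * k) := by
    have : (1 : ℝ) ≤ k := by exact_mod_cast hk
    exact Real.logb_nonneg (by norm_num) (by linarith)
  have hmain := (ofReal_entOfObs_iterate_le hA hinv hk hf hgm hg hε n).trans
    (add_le_add_right (mul_le_mul_right
      (lintegral_errorCost_le ν hε hη.le hf hgm hfg hηε) _) _)
  rw [hR, ← ENNReal.ofReal_natCast, ← ENNReal.ofReal_natCast, ← ENNReal.ofReal_mul (by positivity),
    ← ENNReal.ofReal_mul (by positivity), ← ENNReal.ofReal_add hlog (by positivity),
    ← ENNReal.ofReal_add (by positivity) (by positivity),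
    ENNReal.ofReal_le_ofReal_iff (by positivity)] at hmain
  refine hmain.trans_eq ?_
  push_cast
  ring

theorem ofReal_kolSinai_inducedMap_le {ν : Measure (Bin × Bin)} [IsProbabilityMeasure ν]
    (hA : ν Aset = 1) (hinv : MeasurePreserving inducedMap ν ν) :
    ENNReal.ofReal (kolSinai inducedMap ν) ≤ 2 + ∫⁻ p, excessCost p ∂ν := by
  by_cases htop : 2 + ∫⁻ p, excessCost p ∂ν = ⊤
  · rw [htop]
    exact le_top
  · have hr : 0 ≤ (2 + ∫⁻ p, excessCost p ∂ν).toReal := ENNReal.toReal_nonneg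
    refine ENNReal.ofReal_le_of_le_toReal ?_
    exact Real.iSup_le (fun k => Real.iSup_le (fun f => entObsT_inducedMap_le hA hinv hr
      (ENNReal.ofReal_toReal htop).symm f.2) hr) hr

/-- the entropy estimate for the induced system on the pin set. -/
theorem induced_entropy_bound (ν : Measure (Bin × Bin)) (hν : IsProbabilityMeasure ν)
    (hA : ν Aset = 1) (hinv : MeasurePreserving inducedMap ν ν) :
    ENNReal.ofReal (kolSinai inducedMap ν) ≤ 2 +
      ∑' j : ℕ,
        (ENNReal.ofReal ((ν (Qjs (j + 1) 0)).toReal * (8 + 3 * Real.logb 2 (j + 1))) +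
          ∑ s ∈ Finset.Icc 1 (Nat.log 2 (j + 1) - 3),
            ENNReal.ofReal ((ν (Qjs (j + 1) s)).toReal *
              ((j + 1) * (1 / 2 : ℝ) ^ s + 3 * Real.logb 2 (j + 1)))) := by
  refine (ofReal_kolSinai_inducedMap_le hA hinv).trans_eq ?_
  rw [lintegral_excessCost]
  congr 1
  refine tsum_congr fun j => ?_
  rw [classes, Finset.sum_insert (by simp)]
  congr 1
  · simp only [classCost, if_true, Nat.cast_add, Nat.cast_one]
  · refine Finset.sum_congr rfl fun s hs => ?_
    have hs0 : s ≠ 0 := by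
      have := (Finset.mem_Icc.1 hs).1
      omega
    simp only [classCost, hs0, if_false, Nat.cast_add, Nat.cast_one]

end PhaseTransitions
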